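/- Let G be a finite group, N a normal subgroup of G, and p a prime. Then |S_{p'}^G(N)|_p = |N ∩ Z(G)|_p if and only if Z(P) ∩ N ≤ Z(G) for every Sylow p-subgroup P of G. -/

import Mathlib

/-- A normal subgroup has index prime to `p` exactly when it contains every `p`-element. -/
theorem Subgroup.not_dvd_index_iff_forall_pow_eq_one {G : Type*} [Group G] [Finite G]
    (p : ℕ) [Fact p.Prime] (H : Subgroup G) [H.Normal] :
    ¬ p ∣ H.index ↔ ∀ x : G, ∀ k : ℕ, x ^ p ^ k = 1 → x ∈ H := by
  constructor
  · intro h x k hx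
    rw [← QuotientGroup.eq_one_iff]
    have h₁ : orderOf (x : G ⧸ H) ∣ p ^ k := by
      rw [orderOf_dvd_iff_pow_eq_one, ← QuotientGroup.mk_pow, hx, QuotientGroup.mk_one]
    have h₂ : orderOf (x : G ⧸ H) ∣ H.index := _root_.orderOf_dvd_natCard _
    have hc : (p ^ k).Coprime H.index :=
      Nat.Coprime.pow_left _ (((Fact.out : p.Prime).coprime_iff_not_dvd).2 h)
    exact orderOf_eq_one_iff.1 (Nat.eq_one_of_dvd_coprimes hc h₁ h₂)
  · intro h hd
    obtain ⟨Q⟩ : Nonempty (Sylow p G) := inferInstance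
    have hQ : (Q : Subgroup G) ≤ H := fun x hx ↦ by
      obtain ⟨k, hk⟩ := Q.isPGroup' ⟨x, hx⟩
      exact h x k (by simpa [Subtype.ext_iff] using hk)
    exact Q.not_dvd_index (hd.trans (Subgroup.index_dvd_of_le hQ))

/-- A union of cosets of `Z` has `|Z|` times as many elements as its image modulo `Z`. -/
theorem Subgroup.card_eq_card_mul_card_image_mk {G : Type*} [Group G] (Z : Subgroup G)
    (S : Set G) (hS : ∀ g ∈ S, ∀ z ∈ Z, g * z ∈ S) :
    Nat.card S = Nat.card Z * Nat.card ((QuotientGroup.mk : G → G ⧸ Z) '' S) := by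
  have h : (QuotientGroup.mk : G → G ⧸ Z) ⁻¹' (QuotientGroup.mk '' S) = S := by
    refine Set.Subset.antisymm ?_ (Set.subset_preimage_image _ _)
    rintro x ⟨g, hg, hgx⟩
    simpa using hS g hg _ (QuotientGroup.eq.1 hgx)
  rw [← Nat.card_prod, ← Nat.card_congr (QuotientGroup.preimageMkEquivSubgroupProdSet Z _), h]

/-- If `Z` is central, the `G`-class of `g` has size prime to `p`, and the `p`-element `x`
centralizes `g` modulo `Z`, then `x` centralizes `g`. -/
theorem Subgroup.mem_centralizer_singleton_of_not_dvd_index {G : Type*} [Group G] [Finite G]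
    (p : ℕ) [Fact p.Prime] (Z : Subgroup G) [Z.Normal] (hZ : Z ≤ Subgroup.center G) {g x : G}
    (hg : ¬ p ∣ (Subgroup.centralizer {g}).index) {k : ℕ} (hx : x ^ p ^ k = 1)
    (hxg : Commute (x : G ⧸ Z) (g : G ⧸ Z)) : x ∈ Subgroup.centralizer {g} := by
  set K : Subgroup G := (Subgroup.centralizer {(g : G ⧸ Z)}).comap (QuotientGroup.mk' Z) with hK
  have mem_K {y : G} : y ∈ K ↔ (g : G ⧸ Z) * y = y * g := by
    simp [hK, Subgroup.mem_centralizer_iff]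
  have mem_C {y : G} : y ∈ Subgroup.centralizer {g} ↔ g * y = y * g := by
    simp [Subgroup.mem_centralizer_iff]
  have hCK : Subgroup.centralizer {g} ≤ K := fun y hy ↦ by
    rw [mem_K, ← QuotientGroup.mk_mul, mem_C.1 hy, QuotientGroup.mk_mul]
  have hn : ((Subgroup.centralizer {g}).subgroupOf K).Normal := by
    refine ⟨fun c hc y ↦ ?_⟩
    rw [Subgroup.mem_subgroupOf, mem_C] at hc ⊢
    obtain ⟨y, hy⟩ := y
    have hz : (g * y)⁻¹ * (y * g) ∈ Subgroup.center G := by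
      apply hZ
      rw [← QuotientGroup.eq]
      simpa using mem_K.1 hy
    obtain ⟨z, hz', hyz⟩ : ∃ z ∈ Subgroup.center G, y * g = g * y * z :=
      ⟨_, hz, by group⟩
    have hzc := Subgroup.mem_center_iff.1 hz'
    push_cast
    have e : g * y = y * g * z⁻¹ := by rw [hyz]; group
    have hzi (a : G) : a * z⁻¹ = z⁻¹ * a :=
      Subgroup.mem_center_iff.1 (inv_mem hz') a
    have e' : y⁻¹ * g = g * y⁻¹ * z⁻¹ := by
      rw [eq_mul_inv_iff_mul_eq, ← mul_right_inj y, ← mul_left_inj y]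
      simp only [mul_assoc, mul_inv_cancel_left, inv_mul_cancel, mul_one]
      rw [← hzc y, ← mul_assoc, ← hyz]
    calc g * (y * c * y⁻¹) = (g * y) * c * y⁻¹ := by group
      _ = y * g * (z⁻¹ * c) * y⁻¹ := by rw [e]; group
      _ = y * (g * c) * (z⁻¹ * y⁻¹) := by rw [← hzi]; group
      _ = y * c * (g * y⁻¹ * z⁻¹) := by rw [hc, ← hzi]; group
      _ = y * c * y⁻¹ * g := by rw [← e']; group
  have hd : ¬ p ∣ ((Subgroup.centralizer {g}).subgroupOf K).index := fun h ↦
    hg (h.trans (Subgroup.relIndex_dvd_index_of_le hCK))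
  exact (Subgroup.not_dvd_index_iff_forall_pow_eq_one p _).1 hd ⟨x, mem_K.2 hxg.eq.symm⟩ k
    (Subtype.ext (by simpa using hx))

/-- The index of the centralizer of an element is invariant under conjugation. -/
theorem Subgroup.index_centralizer_conj {G : Type*} [Group G] (x g : G) :
    (Subgroup.centralizer {x * g * x⁻¹}).index = (Subgroup.centralizer {g}).index := by
  rw [← Subgroup.index_map_equiv (Subgroup.centralizer {g}) (MulAut.conj x)]
  congr 1
  ext y
  simp only [Subgroup.mem_centralizer_iff, Set.mem_singleton_iff, forall_eq, Subgroup.mem_map]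
  constructor
  · intro h
    refine ⟨x⁻¹ * y * x, ?_, by simp [mul_assoc]⟩
    calc g * (x⁻¹ * y * x) = x⁻¹ * (x * g * x⁻¹ * y) * x := by group
      _ = x⁻¹ * y * x * g := by rw [h]; group
  · rintro ⟨c, hc, rfl⟩
    calc x * g * x⁻¹ * (x * c * x⁻¹) = x * (g * c) * x⁻¹ := by group
      _ = x * c * x⁻¹ * (x * g * x⁻¹) := by rw [hc]; group

/-- Multiplying by a central element does not change the centralizer. -/
theorem Subgroup.centralizer_singleton_mul_of_mem_center {G : Type*} [Group G] (g : G) {z : G}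
    (hz : z ∈ Subgroup.center G) :
    Subgroup.centralizer {g * z} = Subgroup.centralizer {g} := by
  ext y
  simp only [Subgroup.mem_centralizer_iff, Set.mem_singleton_iff, forall_eq]
  rw [mul_assoc, ← Subgroup.mem_center_iff.1 hz y, ← mul_assoc, ← mul_assoc, mul_left_inj]

/-- If a `p`-group acts on a type, an invariant finite set is congruent modulo `p` to the set of
its fixed points. -/
theorem IsPGroup.card_modEq_card_inter_fixedPoints {p : ℕ} [Fact p.Prime] {P X : Type*} [Group P]
    (hP : IsPGroup p P) [MulAction P X] [Finite X] (T : Set X)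
    (hT : ∀ (x : P), ∀ t ∈ T, x • t ∈ T) :
    Nat.card T ≡ Nat.card ↥(T ∩ MulAction.fixedPoints P X) [MOD p] := by
  let T' : SubMulAction P X := ⟨T, fun x _ ht ↦ hT x _ ht⟩
  have h := hP.card_modEq_card_fixedPoints T'
  have e : Nat.card (MulAction.fixedPoints P T') =
      Nat.card ↥(T ∩ MulAction.fixedPoints P X) :=
    Nat.card_congr
      { toFun := fun t ↦ ⟨t.1.1, t.1.2, fun x ↦ congrArg Subtype.val (t.2 x)⟩
        invFun := fun t ↦ ⟨⟨t.1, t.2.1⟩, fun x ↦ Subtype.ext (t.2.2 x)⟩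
        left_inv := fun _ ↦ rfl
        right_inv := fun _ ↦ rfl }
  rwa [e] at h

/-- Modulo `N ∩ Z(G)`, the elements of `N` with class size prime to `p` are congruent in number to
those of `N` centralizing a Sylow `p`-subgroup `P`. -/
theorem Sylow.card_image_mk_modEq {G : Type*} [Group G] [Finite G] (N Z : Subgroup G)
    [N.Normal] [Z.Normal] (hZ : Z ≤ Subgroup.center G) (p : ℕ) [Fact p.Prime] (P : Sylow p G) :
    Nat.card ((QuotientGroup.mk : G → G ⧸ Z) ''
        {g | g ∈ N ∧ ¬ p ∣ (Subgroup.centralizer {g}).index}) ≡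
      Nat.card ((QuotientGroup.mk : G → G ⧸ Z) ''
        ((N ⊓ Subgroup.centralizer (P : Set G) : Subgroup G) : Set G)) [MOD p] := by
  let : MulAction P (G ⧸ Z) := MulAction.compHom (G ⧸ Z)
    ((MulAut.conj (G := G ⧸ Z)).comp ((QuotientGroup.mk' Z).comp (P : Subgroup G).subtype))
  have smul_mk (x : P) (g : G) : x • (g : G ⧸ Z) = ((x * g * (x : G)⁻¹ : G) : G ⧸ Z) := rfl
  convert P.isPGroup'.card_modEq_card_inter_fixedPoints (X := G ⧸ Z) _ ?_ using 3
  · ext t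
    constructor
    · rintro ⟨g, ⟨hgN, hgP⟩, rfl⟩
      have hc (x : P) : x * g = g * x := Subgroup.mem_centralizer_iff.1 hgP x x.2
      refine ⟨⟨g, ⟨hgN, fun h ↦ P.not_dvd_index (h.trans (Subgroup.index_dvd_of_le ?_))⟩, rfl⟩, ?_⟩
      · intro x hx
        simpa [Subgroup.mem_centralizer_iff] using (hc ⟨x, hx⟩).symm
      · intro x
        rw [smul_mk, hc, mul_inv_cancel_right]
    · rintro ⟨⟨g, ⟨hgN, hg⟩, rfl⟩, hfix⟩
      refine ⟨g, ⟨hgN, Subgroup.mem_centralizer_iff.2 fun x hx ↦ ?_⟩, rfl⟩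
      obtain ⟨k, hk⟩ := P.isPGroup' ⟨x, hx⟩
      have hxg : Commute (x : G ⧸ Z) (g : G ⧸ Z) := by
        have := hfix ⟨x, hx⟩
        rw [smul_mk, QuotientGroup.mk_mul, QuotientGroup.mk_mul, QuotientGroup.mk_inv,
          mul_inv_eq_iff_eq_mul] at this
        exact this
      have := Subgroup.mem_centralizer_singleton_of_not_dvd_index p Z hZ hg
        (by simpa [Subtype.ext_iff] using hk) hxg
      simpa [Subgroup.mem_centralizer_iff, eq_comm] using this
  · rintro x _ ⟨g, ⟨hgN, hg⟩, rfl⟩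
    exact ⟨x * g * (x : G)⁻¹, ⟨‹N.Normal›.conj_mem g hgN x,
      by rwa [Subgroup.index_centralizer_conj]⟩, (smul_mk x g).symm⟩

/-- A `p`-element centralizing a Sylow `p`-subgroup lies in it. -/
theorem Sylow.mem_of_mem_centralizer {G : Type*} [Group G] {p : ℕ} (P : Sylow p G)
    {x : G} (hx : x ∈ Subgroup.centralizer (P : Set G)) {k : ℕ} (hk : x ^ p ^ k = 1) : x ∈ P := by
  have hpx : IsPGroup p (Subgroup.zpowers x) := by
    rintro ⟨_, n, rfl⟩
    refine ⟨k, Subtype.ext ?_⟩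
    change (x ^ n) ^ p ^ k = 1
    rw [← zpow_natCast, zpow_comm, zpow_natCast, hk, one_zpow]
  have h : x ∈ Subgroup.zpowers x ⊓ Subgroup.normalizer (P : Set G) :=
    ⟨Subgroup.mem_zpowers x, Subgroup.centralizer_le_normalizer _ hx⟩
  rw [hpx.inf_normalizer_sylow P] at h
  exact h.2

/-- The index of `N ∩ Z(G)` in `C_N(P)` is prime to `p` iff `Z(P) ∩ N` is central in `G`. -/
theorem Sylow.not_dvd_relIndex_iff {G : Type*} [Group G] [Finite G] (N : Subgroup G)
    [N.Normal] (p : ℕ) [Fact p.Prime] (P : Sylow p G) :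
    ¬ p ∣ (N ⊓ Subgroup.center G).relIndex (N ⊓ Subgroup.centralizer (P : Set G)) ↔
      (Subgroup.center ↥(P : Subgroup G)).map (P : Subgroup G).subtype ⊓ N
        ≤ Subgroup.center G := by
  rw [Subgroup.relIndex, Subgroup.not_dvd_index_iff_forall_pow_eq_one]
  constructor
  · rintro h _ ⟨⟨x, hx, rfl⟩, hxN⟩
    obtain ⟨k, hk⟩ := P.isPGroup' x
    have hxC : (x : G) ∈ N ⊓ Subgroup.centralizer (P : Set G) :=
      ⟨hxN, Subgroup.mem_centralizer_iff.2 fun y hy ↦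
        congrArg Subtype.val (Subgroup.mem_center_iff.1 hx ⟨y, hy⟩)⟩
    exact (h ⟨x, hxC⟩ k (Subtype.ext (by simpa using congrArg Subtype.val hk))).2
  · rintro h ⟨x, hxN, hxC⟩ k hk
    have hxP : x ∈ P := P.mem_of_mem_centralizer hxC (by simpa using congrArg Subtype.val hk)
    refine ⟨hxN, h ⟨⟨⟨x, hxP⟩, ?_, rfl⟩, hxN⟩⟩
    exact Subgroup.mem_center_iff.2 fun y ↦
      Subtype.ext (Subgroup.mem_centralizer_iff.1 hxC y y.2)

/-- |S_{p'}^G(N)|_p = |N ∩ Z(G)|_p iff Z(P) ∩ N ≤ Z(G) for every Sylow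
p-subgroup P of G. -/
theorem stmt_12 {G : Type*} [Group G] [Finite G] (N : Subgroup G) (hN : N.Normal)
    (p : ℕ) (hp : p.Prime) :
    p ^ (Nat.card {g : G | g ∈ N ∧ ¬ p ∣ (Subgroup.centralizer {g}).index}).factorization p
        = p ^ (Nat.card ↥(N ⊓ Subgroup.center G)).factorization p ↔
      ∀ P : Sylow p G,
        (Subgroup.center ↥(P : Subgroup G)).map (P : Subgroup G).subtype ⊓ N
          ≤ Subgroup.center G := by
  have : Fact p.Prime := ⟨hp⟩
  set Z := N ⊓ Subgroup.center G
  set S := {g : G | g ∈ N ∧ ¬ p ∣ (Subgroup.centralizer {g}).index}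
  have hZc : Z ≤ Subgroup.center G := inf_le_right
  have hcardS := Z.card_eq_card_mul_card_image_mk S fun g hg z hz ↦
    ⟨mul_mem hg.1 hz.1, by
      rw [Subgroup.centralizer_singleton_mul_of_mem_center g hz.2]; exact hg.2⟩
  have hS0 : ((QuotientGroup.mk : G → G ⧸ Z) '' S).Nonempty :=
    ⟨_, 1, ⟨one_mem N, by
      have : Subgroup.centralizer {(1 : G)} = ⊤ := by ext; simp [Subgroup.mem_centralizer_iff]
      rw [this, Subgroup.index_top]
      exact hp.not_dvd_one⟩, rfl⟩
  have hT0 : Nat.card ((QuotientGroup.mk : G → G ⧸ Z) '' S) ≠ 0 :=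
    have := hS0.to_subtype
    Nat.card_pos.ne'
  have hleft : p ^ (Nat.card S).factorization p = p ^ (Nat.card Z).factorization p ↔
      ¬ p ∣ Nat.card ((QuotientGroup.mk : G → G ⧸ Z) '' S) := by
    rw [Nat.pow_right_inj hp.two_le, hcardS, Nat.factorization_mul Nat.card_pos.ne' hT0,
      Finsupp.add_apply, Nat.add_eq_left, Nat.factorization_eq_zero_iff]
    tauto
  have hP (P : Sylow p G) : ¬ p ∣ Nat.card ((QuotientGroup.mk : G → G ⧸ Z) '' S) ↔
      (Subgroup.center ↥(P : Subgroup G)).map (P : Subgroup G).subtype ⊓ N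
        ≤ Subgroup.center G := by
    rw [← P.not_dvd_relIndex_iff N p, (P.card_image_mk_modEq N Z hZc p).dvd_iff dvd_rfl]
    have hZC : Z ≤ N ⊓ Subgroup.centralizer (P : Set G) :=
      inf_le_inf_left N (Subgroup.center_le_centralizer _)
    have hcardC := Z.card_eq_card_mul_card_image_mk
      ((N ⊓ Subgroup.centralizer (P : Set G) : Subgroup G) : Set G)
      fun g hg z hz ↦ mul_mem hg (hZC hz)
    have hrel := Subgroup.card_mul_index (Z.subgroupOf (N ⊓ Subgroup.centralizer (P : Set G)))
    rw [Nat.card_congr (Subgroup.subgroupOfEquivOfLe hZC).toEquiv] at hrel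
    rw [Nat.eq_of_mul_eq_mul_left Nat.card_pos (hcardC.symm.trans hrel.symm), Subgroup.relIndex]
  obtain ⟨P⟩ : Nonempty (Sylow p G) := inferInstance
  exact hleft.trans ⟨fun h P ↦ (hP P).1 h, fun h ↦ (hP P).2 (h P)⟩
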